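/- For every n ≥ 4, there is no access structure Γ on n players satisfying monotonicity, no-cloning and no-redundancy in which every set of Γ_min has exactly 2 elements (i.e., no 2-homogeneous access structure on n ≥ 4 players satisfies these three properties). -/

import Mathlib

open Finset

/-- Monotonicity of an access structure on `n` players (players = `Fin n`). -/
def Monotonic {n : ℕ} (Γ : Finset (Fin n) → Prop) : Prop :=
  ∀ A B : Finset (Fin n), Γ A → A ⊆ B → Γ B

/-- No-cloning: a set is authorized iff its complement is not. -/
def NoCloning {n : ℕ} (Γ : Finset (Fin n) → Prop) : Prop :=
  ∀ A : Finset (Fin n), Γ A ↔ ¬ Γ Aᶜ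

/-- `A` is a minimal authorized set of `Γ`. -/
def IsMinimal {n : ℕ} (Γ : Finset (Fin n) → Prop) (A : Finset (Fin n)) : Prop :=
  Γ A ∧ ∀ B : Finset (Fin n), B ⊂ A → ¬ Γ B

/-- No-redundancy: every player lies in some minimal authorized set. -/
def NoRedundancy {n : ℕ} (Γ : Finset (Fin n) → Prop) : Prop :=
  ∀ i : Fin n, ∃ A : Finset (Fin n), IsMinimal Γ A ∧ i ∈ A

noncomputable section

/-- Combine an assignment on `A` and one on `Aᶜ` into a full bit string. -/
def glue {m : ℕ} (A : Finset (Fin m)) (u : {x // x ∈ A} → Fin 2)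
    (w : {x // x ∈ Aᶜ} → Fin 2) : Fin m → Fin 2 :=
  fun x => if h : x ∈ A then u ⟨x, h⟩ else w ⟨x, Finset.mem_compl.mpr h⟩

/-- Reduced density matrix of the pure state `ψ` on the qubit positions in `A`:
the partial trace over the positions outside `A` of `ψψ†`. -/
def reducedDensity {m : ℕ} (ψ : (Fin m → Fin 2) → ℂ) (A : Finset (Fin m)) :
    Matrix ({x // x ∈ A} → Fin 2) ({x // x ∈ A} → Fin 2) ℂ :=
  fun u v => ∑ w : {x // x ∈ Aᶜ} → Fin 2,
    ψ (glue A u w) * (starRingEnd ℂ) (ψ (glue A v w))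

/-- The reduction of `ψ` to `A` is maximally mixed, i.e. equals `2^{-|A|} · I`. -/
def MaximallyMixed {m : ℕ} (ψ : (Fin m → Fin 2) → ℂ) (A : Finset (Fin m)) : Prop :=
  reducedDensity ψ A =
    ((2 : ℂ) ^ A.card)⁻¹ •
      (1 : Matrix ({x // x ∈ A} → Fin 2) ({x // x ∈ A} → Fin 2) ℂ)

open Classical in
/-- Von Neumann entropy (natural logarithm): sum of `-λ log λ` over the eigenvalues. -/
def vnEntropy {ι : Type} [Fintype ι] [DecidableEq ι] (ρ : Matrix ι ι ℂ) : ℝ :=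
  if h : ρ.IsHermitian then ∑ i, Real.negMulLog (h.eigenvalues i) else 0

/-- Entropy of the reduction of `ψ` to the set `A` of qubit positions. -/
def Sent {m : ℕ} (ψ : (Fin m → Fin 2) → ℂ) (A : Finset (Fin m)) : ℝ :=
  vnEntropy (reducedDensity ψ A)

/-- The qubit positions (in `{0,1,…,n} = Fin (n+1)`, where `0` is the reference qubit)
of a set of players `A ⊆ Fin n`: player `i` holds position `i.succ`. -/
def posOf {n : ℕ} (A : Finset (Fin n)) : Finset (Fin (n + 1)) := A.image Fin.succ

/-- `ψ` is a pure QSS state for the access structure `Γ`: a normalized pure state of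
`n+1` qubits (position `0` being the reference qubit `R`) satisfying Recoverability
`S(R) + S(A) - S(R ∪ A) = 2 log 2` for authorized `A` and Secrecy
`S(R) + S(B) - S(R ∪ B) = 0` for unauthorized `B`. -/
structure IsPureQSSState {n : ℕ} (Γ : Finset (Fin n) → Prop)
    (ψ : (Fin (n + 1) → Fin 2) → ℂ) : Prop where
  normalized : ∑ x : Fin (n + 1) → Fin 2, ‖ψ x‖ ^ 2 = 1
  recover : ∀ A : Finset (Fin n), Γ A →
    Sent ψ {0} + Sent ψ (posOf A) - Sent ψ (insert 0 (posOf A)) = 2 * Real.log 2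
  secrecy : ∀ B : Finset (Fin n), ¬ Γ B →
    Sent ψ {0} + Sent ψ (posOf B) - Sent ψ (insert 0 (posOf B)) = 0

end

theorem aux_exists_min {n : ℕ} (Γ : Finset (Fin n) → Prop) (A : Finset (Fin n)) (h : Γ A) :
    ∃ B, B ⊆ A ∧ IsMinimal Γ B := by
  induction A using Finset.strongInduction with
  | H A ih =>
    by_cases hm : ∃ B, B ⊂ A ∧ Γ B
    · obtain ⟨B, hB, hG⟩ := hm
      obtain ⟨C, hC, hCm⟩ := ih B hB hG
      exact ⟨C, hC.trans hB.subset, hCm⟩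
    · exact ⟨A, Finset.Subset.refl _, h, fun B hB hG => hm ⟨B, hB, hG⟩⟩

theorem stmt5 (n : ℕ) (hn : 4 ≤ n) :
    ¬ ∃ Γ : Finset (Fin n) → Prop, Monotonic Γ ∧ NoCloning Γ ∧ NoRedundancy Γ ∧
      (∀ A : Finset (Fin n), IsMinimal Γ A → A.card = 2) := by
  rintro ⟨Γ, hmono, hnc, hnr, hcard⟩
  have hint : ∀ A B, IsMinimal Γ A → IsMinimal Γ B → ∃ x, x ∈ A ∧ x ∈ B := by
    intro A B hA hB
    by_contra hne
    push Not at hne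
    exact (hnc A).1 hA.1 (hmono B _ hB.1 (fun x hx => Finset.mem_compl.2 (fun hxA => hne x hxA hx)))
  have havoid : ∀ x : Fin n, ∃ B, x ∉ B ∧ IsMinimal Γ B := by
    intro x
    have h1 : ¬ Γ {x} := by
      intro h
      obtain ⟨B, hB, hm⟩ := aux_exists_min Γ _ h
      have := Finset.card_le_card hB
      rw [hcard B hm] at this
      simp at this
    have h2 : Γ ({x}ᶜ) := by
      by_contra h
      exact h1 ((hnc {x}).2 h)
    obtain ⟨B, hB, hm⟩ := aux_exists_min Γ _ h2
    exact ⟨B, fun hx => by simpa using hB hx, hm⟩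
  obtain ⟨A, -, hA⟩ := havoid ⟨0, by omega⟩
  obtain ⟨a, b, hab, rfl⟩ := Finset.card_eq_two.1 (hcard A hA)
  obtain ⟨B, haB, hB⟩ := havoid a
  obtain ⟨C, hbC, hC⟩ := havoid b
  have hbB : b ∈ B := by
    obtain ⟨x, hx, hxB⟩ := hint _ _ hA hB
    simp only [Finset.mem_insert, Finset.mem_singleton] at hx
    rcases hx with rfl | rfl
    · exact absurd hxB haB
    · exact hxB
  have haC : a ∈ C := by
    obtain ⟨x, hx, hxC⟩ := hint _ _ hA hC
    simp only [Finset.mem_insert, Finset.mem_singleton] at hx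
    rcases hx with rfl | rfl
    · exact hxC
    · exact absurd hxC hbC
  obtain ⟨c, hcB, hcC⟩ := hint _ _ hB hC
  have hca : c ≠ a := fun h => haB (h ▸ hcB)
  have hcb : c ≠ b := fun h => hbC (h ▸ hcC)
  have hBe : ({b, c} : Finset (Fin n)) = B := by
    apply Finset.eq_of_subset_of_card_le
    · intro x hx
      simp only [Finset.mem_insert, Finset.mem_singleton] at hx
      rcases hx with rfl | rfl <;> assumption
    · rw [hcard B hB, Finset.card_pair hcb.symm]
  have hCe : ({a, c} : Finset (Fin n)) = C := by
    apply Finset.eq_of_subset_of_card_le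
    · intro x hx
      simp only [Finset.mem_insert, Finset.mem_singleton] at hx
      rcases hx with rfl | rfl <;> assumption
    · rw [hcard C hC, Finset.card_pair hca.symm]
  obtain ⟨d, hd⟩ : ∃ d : Fin n, d ∉ ({a, b, c} : Finset (Fin n)) := by
    by_contra h
    push Not at h
    have h1 : (Finset.univ : Finset (Fin n)) ⊆ {a, b, c} := fun x _ => h x
    have h2 := Finset.card_le_card h1
    have h3 := Finset.card_le_three (a := a) (b := b) (c := c)
    simp only [Finset.card_univ, Fintype.card_fin] at h2
    omega
  obtain ⟨D, hD, hdD⟩ := hnr d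
  obtain ⟨x, hx, hxD⟩ := hint _ _ hA hD
  obtain ⟨y, hy, hyD⟩ := hint _ _ hB hD
  obtain ⟨z, hz, hzD⟩ := hint _ _ hC hD
  obtain ⟨p, q, hpq, rfl⟩ := Finset.card_eq_two.1 (hcard D hD)
  subst hBe hCe
  simp only [Finset.mem_insert, Finset.mem_singleton] at *
  grind
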